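/- There do not exist real numbers A, B, p, u with A > 0 and B > 0 satisfying the three equations 2Bp + 2u = 0, 3A + 2Bp² + 2B + 4pu + 3u² = 0, and 8Ap + 4Bp + Bu + 8pu² + 4u = 0. -/

import Mathlib

/-- Case 1 (`t = 0`) of the exclusion of Case (VII): the specialized system
has no solution with `A > 0` and `B > 0`. -/
theorem case_VII_t_eq_zero_impossible :
    ¬ ∃ A B p u : ℝ, 0 < A ∧ 0 < B ∧
      2 * B * p + 2 * u = 0 ∧
      3 * A + 2 * B * p ^ 2 + 2 * B + 4 * p * u + 3 * u ^ 2 = 0 ∧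
      8 * A * p + 4 * B * p + B * u + 8 * p * u ^ 2 + 4 * u = 0 := by
  rintro ⟨A, B, p, u, hA, hB, h1, h2, h3⟩
  have hu : u = -(B * p) := by linarith
  subst hu
  have h4 : p * (8 * A - B ^ 2 + 8 * B ^ 2 * p ^ 2) = 0 := by linear_combination h3
  rcases mul_eq_zero.mp h4 with hp | h5
  · subst hp
    nlinarith
  · have hB2 : 0 < B ^ 2 := by positivity
    have hp : p ^ 2 < 1 := by
      by_contra hc
      have := mul_le_mul_of_nonneg_left (not_lt.mp hc) hB2.le
      linarith
    have h6 : 3 / 8 * B ^ 2 + 2 * (B * (1 - p ^ 2)) = 0 := by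
      linear_combination h2 - 3 / 8 * h5
    have h7 : 0 < B * (1 - p ^ 2) := mul_pos hB (by linarith)
    linarith
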